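/- arXiv:2010.12131 — 2 statements merged into one kernel-verified Lean document; each statement's English description precedes it below -/
import Mathlib

section
/- Let f ∈ L¹(ℝⁿ) ∩ BV(ℝⁿ). Then lim_{t→0⁺} (1/√t) ∫_{ℝⁿ} ∫_{ℝⁿ} |f(x) − f(y)| (4πt)^{-n/2} e^{-|x−y|²/(4t)} dy dx = (2/√π) |Df|(ℝⁿ). -/
open Real MeasureTheory Filter Topology

/-- The divergence of a vector field `φ : ℝⁿ → ℝⁿ`. -/
noncomputable def eucDiv {n : ℕ}
    (φ : EuclideanSpace ℝ (Fin n) → EuclideanSpace ℝ (Fin n))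
    (x : EuclideanSpace ℝ (Fin n)) : ℝ :=
  ∑ i : Fin n, fderiv ℝ φ x (EuclideanSpace.single i 1) i

/-- The set of values `∫ f div φ` over test vector fields `φ ∈ C_c¹` with
`‖φ‖_∞ ≤ 1`. -/
def divTestVals {n : ℕ} (f : EuclideanSpace ℝ (Fin n) → ℝ) : Set ℝ :=
  {a | ∃ φ : EuclideanSpace ℝ (Fin n) → EuclideanSpace ℝ (Fin n),
    ContDiff ℝ 1 φ ∧ HasCompactSupport φ ∧ (∀ x, ‖φ x‖ ≤ 1) ∧
    a = ∫ x, f x * eucDiv φ x}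

/-- The total variation `|Df|(ℝⁿ)` of `f`. -/
noncomputable def totalVar {n : ℕ} (f : EuclideanSpace ℝ (Fin n) → ℝ) : ℝ :=
  sSup (divTestVals f)

/-- One-dimensional first absolute moment. -/
lemma integral_abs_gauss : ∫ x : ℝ, |x| * Real.exp (-x ^ 2 / 4) = 4 := by
  have h1 : ∫ x : ℝ, |x| * Real.exp (-x ^ 2 / 4)
      = ∫ x : ℝ, (fun y : ℝ => y * Real.exp (-y ^ 2 / 4)) |x| := by
    congr 1; ext x; simp
  rw [h1, integral_comp_abs (f := fun y : ℝ => y * Real.exp (-y ^ 2 / 4))]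
  have := integral_rpow_mul_exp_neg_mul_rpow (p := 2) (q := 1) (b := 1 / 4)
    (by norm_num) (by norm_num) (by norm_num)
  have h2 : ∫ x in Set.Ioi (0 : ℝ), x * Real.exp (-x ^ 2 / 4) = 2 := by
    have e : ∀ x : ℝ, x * Real.exp (-x ^ 2 / 4)
        = x ^ (1 : ℝ) * Real.exp (-(1 / 4) * x ^ (2 : ℝ)) := by
      intro x
      rw [Real.rpow_one, Real.rpow_two]
      congr 2; ring
    simp_rw [e]
    rw [this]
    norm_num [Real.rpow_neg_one]
  rw [h2]; norm_num

lemma integral_gauss4 : ∫ x : ℝ, Real.exp (-x ^ 2 / 4) = Real.sqrt (4 * π) := by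
  have := integral_gaussian (1 / 4)
  convert this using 2
  · ext x; congr 1; ring
  · rw [div_div_eq_mul_div, div_one, mul_comm]

lemma integrable_abs_gauss : Integrable (fun x : ℝ => |x| * Real.exp (-x ^ 2 / 4)) := by
  by_contra h
  have := integral_abs_gauss
  rw [integral_undef h] at this
  norm_num at this

lemma integrable_gauss4 : Integrable (fun x : ℝ => Real.exp (-x ^ 2 / 4)) := by
  by_contra h
  have := integral_gauss4
  rw [integral_undef h] at this
  have h2 : 0 < Real.sqrt (4 * π) := by positivity
  linarith

/-- The Gaussian weight at time one. -/
noncomputable def gK (n : ℕ) (z : EuclideanSpace ℝ (Fin n)) : ℝ :=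
  (4 * π) ^ (-(n : ℝ) / 2) * Real.exp (-‖z‖ ^ 2 / 4)

lemma gK_nonneg {n : ℕ} (z : EuclideanSpace ℝ (Fin n)) : 0 ≤ gK n z := by
  unfold gK; positivity

lemma gK_cont {n : ℕ} : Continuous (gK n) := by
  unfold gK; fun_prop

lemma gauss_coord {n : ℕ} (i0 : Fin n) :
    ∫⁻ z : EuclideanSpace ℝ (Fin n), ENNReal.ofReal (gK n z * |z i0|)
      = ENNReal.ofReal (2 / Real.sqrt π) := by
  have e1 : ∀ z : EuclideanSpace ℝ (Fin n), gK n z * |z i0|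
      = (4 * π) ^ (-(n : ℝ) / 2) *
        ∏ i, (if i = i0 then |z i| * Real.exp (-(z i) ^ 2 / 4) else Real.exp (-(z i) ^ 2 / 4)) := by
    intro z
    have : ∀ i, (if i = i0 then |z i| * Real.exp (-(z i) ^ 2 / 4) else Real.exp (-(z i) ^ 2 / 4))
       = (if i = i0 then |z i| else 1) * Real.exp (-(z i) ^ 2 / 4) := by
      intro i; split_ifs <;> simp
    simp_rw [this]
    rw [Finset.prod_mul_distrib, ← Real.exp_sum, Finset.prod_ite_eq' Finset.univ i0]
    simp only [Finset.mem_univ, if_true]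
    unfold gK
    rw [EuclideanSpace.norm_sq_eq]
    simp only [Real.norm_eq_abs, sq_abs, neg_div, Finset.sum_neg_distrib, Finset.sum_div]
    ring
  let F : Fin n → ℝ → ℝ := fun i x =>
    if i = i0 then |x| * Real.exp (-x ^ 2 / 4) else Real.exp (-x ^ 2 / 4)
  have hF : ∀ i, Integrable (F i) := by
    intro i
    by_cases h : i = i0
    · simpa [F, h] using integrable_abs_gauss
    · simpa [F, h] using integrable_gauss4
  have hI : Integrable (fun z : Fin n → ℝ => ∏ i, F i (z i)) := Integrable.fintype_prod hF
  have mp := EuclideanSpace.volume_preserving_symm_measurableEquiv_toLp (Fin n)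
  have hI2 : Integrable (fun z : EuclideanSpace ℝ (Fin n) => ∏ i, F i (z i)) := by
    have := (mp.integrable_comp_emb (MeasurableEquiv.measurableEmbedding _)).2 hI
    exact this
  have hv : ∫ z : EuclideanSpace ℝ (Fin n), ∏ i, F i (z i) = ∏ i, ∫ x, F i x := by
    rw [← integral_fintype_prod_volume_eq_prod]
    exact mp.integral_comp (MeasurableEquiv.measurableEmbedding _)
      (fun z : Fin n → ℝ => ∏ i, F i (z i))
  rw [← ofReal_integral_eq_lintegral_ofReal]
  · congr 1
    simp_rw [e1]
    rw [integral_const_mul]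
    change _ * ∫ z : EuclideanSpace ℝ (Fin n), ∏ i, F i (z i) = _
    rw [hv]
    have : ∀ i, ∫ x, F i x = (if i = i0 then 4 / Real.sqrt (4 * π) else 1) * Real.sqrt (4 * π) := by
      intro i
      have : Real.sqrt (4 * π) ≠ 0 := by positivity
      by_cases h : i = i0
      · simp only [F, h, if_true]; rw [integral_abs_gauss]; field_simp
      · simp only [F, h, if_false]; rw [integral_gauss4]; simp
    simp_rw [this]
    rw [Finset.prod_mul_distrib, Finset.prod_ite_eq' Finset.univ i0]
    simp only [Finset.mem_univ, if_true, Finset.prod_const, Finset.card_univ, Fintype.card_fin]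
    have h4 : Real.sqrt (4 * π) = 2 * Real.sqrt π := by
      rw [Real.sqrt_mul (by norm_num)]; congr 1
      rw [show (4 : ℝ) = 2 ^ 2 by norm_num]; simp
    have h5 : (4 * π) ^ (-(n : ℝ) / 2) * Real.sqrt (4 * π) ^ n = 1 := by
      rw [Real.sqrt_eq_rpow, ← Real.rpow_natCast, ← Real.rpow_mul (by positivity),
        ← Real.rpow_add (by positivity)]
      ring_nf; simp
    calc _ = (4 / Real.sqrt (4 * π)) * ((4 * π) ^ (-(n : ℝ) / 2) * Real.sqrt (4 * π) ^ n) := by ring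
      _ = _ := by
        rw [h5, h4]; field_simp; norm_num
  · simp_rw [e1]
    exact hI2.const_mul _
  · filter_upwards with z
    exact mul_nonneg (gK_nonneg z) (abs_nonneg _)

lemma gauss_inner {n : ℕ} (v : EuclideanSpace ℝ (Fin n)) :
    ∫⁻ z : EuclideanSpace ℝ (Fin n), ENNReal.ofReal (gK n z * |inner ℝ v z|)
      = ENNReal.ofReal (2 / Real.sqrt π) * ‖v‖ₑ := by
  by_cases hv : v = 0
  · simp [hv]
  have hn : 0 < n := by
    rcases Nat.eq_zero_or_pos n with h | h
    · subst h; exact absurd (Subsingleton.elim v 0) hv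
    · exact h
  let i0 : Fin n := ⟨0, hn⟩
  have hv' : ‖v‖ ≠ 0 := norm_ne_zero_iff.2 hv
  let w : Fin n → EuclideanSpace ℝ (Fin n) := fun _ => (‖v‖)⁻¹ • v
  have hw : Orthonormal ℝ (({i0} : Set (Fin n)).domRestrict w) := by
    constructor
    · rintro ⟨i, hi⟩
      change ‖(‖v‖)⁻¹ • v‖ = 1
      simp [norm_smul, hv']
    · rintro ⟨i, hi⟩ ⟨j, hj⟩ hij
      exfalso; apply hij
      simp only [Set.mem_singleton_iff] at hi hj
      subst hi; subst hj; rfl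
  obtain ⟨b, hb⟩ := hw.exists_orthonormalBasis_extension_of_card_eq (by simp)
  have hb0 : b i0 = (‖v‖)⁻¹ • v := hb i0 rfl
  have hin : ∀ z, inner ℝ v z = ‖v‖ * b.repr z i0 := by
    intro z
    rw [b.repr_apply_apply, hb0, real_inner_smul_left]
    field_simp
  have e : ∀ z, ENNReal.ofReal (gK n z * |inner ℝ v z|)
      = ‖v‖ₑ * ENNReal.ofReal (gK n (b.repr z) * |b.repr z i0|) := by
    intro z
    rw [hin, ← ofReal_norm, ← ENNReal.ofReal_mul (norm_nonneg _)]
    congr 1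
    have : gK n (b.repr z) = gK n z := by unfold gK; rw [LinearIsometryEquiv.norm_map]
    rw [this, abs_mul, abs_of_nonneg (norm_nonneg v)]; ring
  simp_rw [e]
  rw [lintegral_const_mul' _ _ enorm_ne_top]
  rw [b.measurePreserving_repr.lintegral_comp_emb
    (b.repr.toHomeomorph.measurableEmbedding)
    (fun z : EuclideanSpace ℝ (Fin n) => ENNReal.ofReal (gK n z * |z i0|)), gauss_coord, mul_comm]

lemma eucDiv_cont {n : ℕ} {φ : EuclideanSpace ℝ (Fin n) → EuclideanSpace ℝ (Fin n)}
    (hφ : ContDiff ℝ 1 φ) : Continuous (eucDiv φ) := by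
  unfold eucDiv
  have := hφ.continuous_fderiv (by norm_num)
  fun_prop

lemma eucDiv_supp {n : ℕ} {φ : EuclideanSpace ℝ (Fin n) → EuclideanSpace ℝ (Fin n)}
    (hc : HasCompactSupport φ) : HasCompactSupport (eucDiv φ) := by
  have h := hc.fderiv (𝕜 := ℝ)
  refine h.mono ?_
  intro x hx
  rw [Function.mem_support] at hx ⊢
  intro h0
  apply hx
  simp [eucDiv, h0]

lemma gradient_cont {n : ℕ} {g : EuclideanSpace ℝ (Fin n) → ℝ} (hg : ContDiff ℝ 1 g) :
    Continuous (gradient g) := by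
  unfold gradient
  exact (InnerProductSpace.toDual ℝ (EuclideanSpace ℝ (Fin n))).symm.continuous.comp
    (hg.continuous_fderiv (by norm_num))

lemma gradient_contDiff {n : ℕ} {g : EuclideanSpace ℝ (Fin n) → ℝ} (hg : ContDiff ℝ 2 g) :
    ContDiff ℝ 1 (gradient g) := by
  unfold gradient
  exact (InnerProductSpace.toDual ℝ (EuclideanSpace ℝ (Fin n))).symm.contDiff.comp
    (hg.fderiv_right (m := 1) (by norm_num))

lemma inner_gradient' {n : ℕ} {g : EuclideanSpace ℝ (Fin n) → ℝ}
    (x v : EuclideanSpace ℝ (Fin n)) : inner ℝ (gradient g x) v = fderiv ℝ g x v := by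
  simp [gradient]

lemma ibp {n : ℕ} {g : EuclideanSpace ℝ (Fin n) → ℝ} (hg : ContDiff ℝ 1 g)
    {φ : EuclideanSpace ℝ (Fin n) → EuclideanSpace ℝ (Fin n)}
    (hφ : ContDiff ℝ 1 φ) (hc : HasCompactSupport φ) :
    ∫ x, g x * eucDiv φ x = - ∫ x, inner ℝ (gradient g x) (φ x) := by
  have hφi : ∀ i, ContDiff ℝ 1 (fun x => φ x i) := by
    intro i; exact (contDiff_euclidean.1 hφ) i
  have hci : ∀ i, HasCompactSupport (fun x => φ x i) := by
    intro i
    exact hc.comp_left (g := fun y : EuclideanSpace ℝ (Fin n) => y i) rfl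
  have hd : ∀ i x, fderiv ℝ φ x (EuclideanSpace.single i 1) i
      = fderiv ℝ (fun y => φ y i) x (EuclideanSpace.single i 1) := by
    intro i x
    have h1 : HasFDerivAt φ (fderiv ℝ φ x) x :=
      (hφ.differentiable (by norm_num) x).hasFDerivAt
    have h2 := (EuclideanSpace.proj i : EuclideanSpace ℝ (Fin n) →L[ℝ] ℝ).hasFDerivAt.comp x h1
    have h3 : HasFDerivAt (fun y => φ y i)
      ((EuclideanSpace.proj i : EuclideanSpace ℝ (Fin n) →L[ℝ] ℝ).comp (fderiv ℝ φ x)) x := h2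
    rw [h3.fderiv]; rfl
  have hgc := hg.continuous
  have hgf := hg.continuous_fderiv (by norm_num)
  have i1 : ∀ i : Fin n, Integrable (fun x => fderiv ℝ g x (EuclideanSpace.single i 1) * φ x i) := by
    intro i
    apply Continuous.integrable_of_hasCompactSupport
    · have := (hφi i).continuous; fun_prop
    · exact (hci i).mul_left
  have i2 : ∀ i : Fin n, Integrable
      (fun x => g x * fderiv ℝ (fun y => φ y i) x (EuclideanSpace.single i 1)) := by
    intro i
    apply Continuous.integrable_of_hasCompactSupport
    · have := (hφi i).continuous_fderiv (by norm_num); fun_prop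
    · exact HasCompactSupport.mul_left ((hci i).fderiv_apply (𝕜 := ℝ) _)
  have i3 : ∀ i : Fin n, Integrable (fun x => g x * φ x i) := by
    intro i
    apply Continuous.integrable_of_hasCompactSupport
    · have := (hφi i).continuous; fun_prop
    · exact (hci i).mul_left
  have key : ∀ i : Fin n, ∫ x, g x * fderiv ℝ (fun y => φ y i) x (EuclideanSpace.single i 1)
      = - ∫ x, fderiv ℝ g x (EuclideanSpace.single i 1) * φ x i := by
    intro i
    exact integral_mul_fderiv_eq_neg_fderiv_mul_of_integrable (i1 i) (i2 i) (i3 i)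
      (fun x _ => hg.differentiable (by norm_num) x)
      (fun x _ => (hφi i).differentiable (by norm_num) x)
  have e2 : ∀ x, inner ℝ (gradient g x) (φ x)
      = ∑ i, fderiv ℝ g x (EuclideanSpace.single i 1) * φ x i := by
    intro x
    rw [PiLp.inner_apply]
    apply Finset.sum_congr rfl
    intro i _
    have h : fderiv ℝ g x (EuclideanSpace.single i 1) = gradient g x i := by
      rw [← inner_gradient', EuclideanSpace.inner_single_right]; simp
    rw [h]
    simp [mul_comm]
  simp_rw [e2, eucDiv, Finset.mul_sum, hd]
  rw [integral_finsetSum _ (fun i _ => i1 i), integral_finsetSum _ (fun i _ => i2 i),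
    ← Finset.sum_neg_distrib]
  exact Finset.sum_congr rfl (fun i _ => key i)

lemma test_le_grad {n : ℕ} {g : EuclideanSpace ℝ (Fin n) → ℝ} (hg : ContDiff ℝ 1 g)
    {φ : EuclideanSpace ℝ (Fin n) → EuclideanSpace ℝ (Fin n)}
    (hφ : ContDiff ℝ 1 φ) (hc : HasCompactSupport φ) (h1 : ∀ x, ‖φ x‖ ≤ 1) :
    ENNReal.ofReal (∫ x, g x * eucDiv φ x) ≤ ∫⁻ x, ‖gradient g x‖ₑ := by
  rw [ibp hg hφ hc, ← integral_neg]
  have hle : ENNReal.ofReal (∫ x, -inner ℝ (gradient g x) (φ x))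
      ≤ ‖∫ x, -inner ℝ (gradient g x) (φ x)‖ₑ := by
    rw [← ofReal_norm]
    exact ENNReal.ofReal_le_ofReal (le_abs_self _)
  refine hle.trans ((enorm_integral_le_lintegral_enorm _).trans (lintegral_mono fun x => ?_))
  rw [enorm_neg, ← ofReal_norm, ← ofReal_norm]
  apply ENNReal.ofReal_le_ofReal
  refine (norm_inner_le_norm _ _).trans ?_
  exact mul_le_of_le_one_right (norm_nonneg _) (h1 x)

lemma grad_le_of_test {n : ℕ} {g : EuclideanSpace ℝ (Fin n) → ℝ} (hg : ContDiff ℝ 2 g) {V : ℝ}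
    (hV : ∀ φ : EuclideanSpace ℝ (Fin n) → EuclideanSpace ℝ (Fin n),
      ContDiff ℝ 1 φ → HasCompactSupport φ → (∀ x, ‖φ x‖ ≤ 1) →
      ∫ x, g x * eucDiv φ x ≤ V) :
    ∫⁻ x, ‖gradient g x‖ₑ ≤ ENNReal.ofReal V := by
  have hg1 : ContDiff ℝ 1 g := hg.of_le (by norm_num)
  let χ : ℕ → ContDiffBump (0 : EuclideanSpace ℝ (Fin n)) := fun k =>
    ⟨(k : ℝ) + 1, (k : ℝ) + 2, by positivity, by linarith⟩
  let δ : ℕ → ℝ := fun k => 1 / ((k : ℝ) + 1)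
  have hδ : ∀ k, 0 < δ k := fun k => by positivity
  have hδ0 : Tendsto δ atTop (𝓝 0) := tendsto_one_div_add_atTop_nhds_zero_nat
  let s : ℕ → EuclideanSpace ℝ (Fin n) → ℝ := fun k x =>
    Real.sqrt (‖gradient g x‖ ^ 2 + δ k ^ 2)
  have hs : ∀ k x, 0 < s k x := by
    intro k x; have := hδ k; simp only [s]; positivity
  have hsle : ∀ k x, ‖gradient g x‖ ≤ s k x := by
    intro k x; apply Real.le_sqrt_of_sq_le; nlinarith [sq_nonneg (δ k)]
  let φ : ℕ → EuclideanSpace ℝ (Fin n) → EuclideanSpace ℝ (Fin n) := fun k x =>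
    -((χ k x * (s k x)⁻¹) • gradient g x)
  have hgrad := gradient_contDiff hg
  have hsC : ∀ k, ContDiff ℝ 1 (s k) := by
    intro k
    apply ContDiff.sqrt
    · exact (hgrad.norm_sq ℝ).add contDiff_const
    · intro x; have := hδ k; positivity
  have hφC : ∀ k, ContDiff ℝ 1 (φ k) := by
    intro k
    exact (((χ k).contDiff.mul ((hsC k).inv (fun x => (hs k x).ne'))).smul hgrad).neg
  have hφc : ∀ k, HasCompactSupport (φ k) := by
    intro k
    refine (χ k).hasCompactSupport.mono ?_
    intro x hx
    rw [Function.mem_support] at hx ⊢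
    intro h0; apply hx; simp [φ, h0]
  have hφ1 : ∀ k x, ‖φ k x‖ ≤ 1 := by
    intro k x
    simp only [φ, norm_neg, norm_smul, norm_mul, norm_inv, Real.norm_eq_abs,
      abs_of_nonneg (χ k).nonneg, abs_of_pos (hs k x)]
    have h1 : (s k x)⁻¹ * ‖gradient g x‖ ≤ 1 := by
      rw [inv_mul_le_iff₀ (hs k x), mul_one]; exact hsle k x
    rw [mul_assoc]
    exact mul_le_one₀ (χ k).le_one (by have := hs k x; positivity) h1
  let F : ℕ → EuclideanSpace ℝ (Fin n) → ℝ := fun k x => χ k x * (‖gradient g x‖ ^ 2 / s k x)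
  have hF0 : ∀ k x, 0 ≤ F k x := by
    intro k x; have := hs k x; have := (χ k).nonneg (x := x); simp only [F]; positivity
  have hFe : ∀ k x, F k x = - inner ℝ (gradient g x) (φ k x) := by
    intro k x
    simp only [F, φ, inner_neg_right, inner_smul_right, real_inner_self_eq_norm_sq]
    ring
  have hFint : ∀ k, ∫ x, F k x ≤ V := by
    intro k
    have := hV (φ k) (hφC k) (hφc k) (hφ1 k)
    rw [ibp hg1 (hφC k) (hφc k), ← integral_neg] at this
    simpa [hFe] using this
  have hFcont : ∀ k, Continuous (F k) := by
    intro k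
    have := (gradient_cont hg1)
    have h2 := (χ k).continuous
    have h3 := (hsC k).continuous
    exact h2.mul ((this.norm.pow 2).div h3 (fun x => (hs k x).ne'))
  have hFi : ∀ k, Integrable (F k) := by
    intro k
    apply (hFcont k).integrable_of_hasCompactSupport
    exact (χ k).hasCompactSupport.mul_right
  have hlim : ∀ x, Tendsto (fun k => F k x) atTop (𝓝 ‖gradient g x‖) := by
    intro x
    have hχ : Tendsto (fun k => χ k x) atTop (𝓝 1) := by
      apply tendsto_const_nhds.congr'
      obtain ⟨m, hm⟩ := exists_nat_ge ‖x‖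
      filter_upwards [eventually_ge_atTop m] with k hk
      symm
      apply (χ k).one_of_mem_closedBall
      simp only [mem_closedBall_zero_iff, χ]
      have : (m : ℝ) ≤ k := by exact_mod_cast hk
      linarith
    have h2 : Tendsto (fun k => ‖gradient g x‖ ^ 2 / s k x) atTop (𝓝 ‖gradient g x‖) := by
      by_cases h0 : gradient g x = 0
      · simp [h0]
      · have hp : 0 < ‖gradient g x‖ := norm_pos_iff.2 h0
        have hs' : Tendsto (fun k => s k x) atTop (𝓝 ‖gradient g x‖) := by
          have : Tendsto (fun k => Real.sqrt (‖gradient g x‖ ^ 2 + δ k ^ 2)) atTop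
              (𝓝 (Real.sqrt (‖gradient g x‖ ^ 2 + 0 ^ 2))) :=
            (Real.continuous_sqrt.tendsto _).comp (tendsto_const_nhds.add (hδ0.pow 2))
          simpa [Real.sqrt_sq hp.le] using this
        have := (tendsto_const_nhds (x := ‖gradient g x‖ ^ 2)).div hs' hp.ne'
        rw [pow_two, mul_div_assoc, div_self hp.ne', mul_one] at this
        rw [pow_two]
        exact this
    simpa using hχ.mul h2
  calc ∫⁻ x, ‖gradient g x‖ₑ = ∫⁻ x, liminf (fun k => ENNReal.ofReal (F k x)) atTop := by
        apply lintegral_congr; intro x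
        rw [← ofReal_norm]
        exact ((ENNReal.tendsto_ofReal (hlim x)).liminf_eq).symm
    _ ≤ liminf (fun k => ∫⁻ x, ENNReal.ofReal (F k x)) atTop :=
        lintegral_liminf_le fun k => (hFcont k).measurable.ennreal_ofReal
    _ ≤ ENNReal.ofReal V := by
        refine liminf_le_of_frequently_le' (Eventually.frequently (Eventually.of_forall fun k => ?_))
        rw [← ofReal_integral_eq_lintegral_ofReal (hFi k) (Eventually.of_forall (hF0 k))]
        exact ENNReal.ofReal_le_ofReal (hFint k)

/-- The rescaled heat-difference functional, with values in `[0, ∞]`. -/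
noncomputable def heatJ {n : ℕ} (f : EuclideanSpace ℝ (Fin n) → ℝ) (h : ℝ) : ENNReal :=
  ∫⁻ z : EuclideanSpace ℝ (Fin n), ∫⁻ x : EuclideanSpace ℝ (Fin n),
    ENNReal.ofReal (gK n z * (|f (x + h • z) - f x| / h))

lemma heatJ_meas {n : ℕ} {f : EuclideanSpace ℝ (Fin n) → ℝ} (hf : Measurable f) (h : ℝ) :
    Measurable (fun p : EuclideanSpace ℝ (Fin n) × EuclideanSpace ℝ (Fin n) =>
      ENNReal.ofReal (gK n p.1 * (|f (p.2 + h • p.1) - f p.2| / h))) := by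
  have h1 : Measurable (fun p : EuclideanSpace ℝ (Fin n) × EuclideanSpace ℝ (Fin n) =>
      f (p.2 + h • p.1)) := hf.comp (by fun_prop)
  have h2 : Measurable (gK n) := gK_cont.measurable
  have h3 : Measurable (fun p : EuclideanSpace ℝ (Fin n) × EuclideanSpace ℝ (Fin n) =>
      |f (p.2 + h • p.1) - f p.2|) := by
    have := (h1.sub (hf.comp measurable_snd)).norm
    exact this
  exact ((h2.comp measurable_fst).mul (h3.div_const h)).ennreal_ofReal

lemma heatJ_meas1 {n : ℕ} {f : EuclideanSpace ℝ (Fin n) → ℝ} (hf : Measurable f) (h : ℝ)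
    (z : EuclideanSpace ℝ (Fin n)) :
    Measurable (fun x : EuclideanSpace ℝ (Fin n) =>
      ENNReal.ofReal (gK n z * (|f (x + h • z) - f x| / h))) := by
  have h1 : Measurable (fun x : EuclideanSpace ℝ (Fin n) => f (x + h • z)) :=
    hf.comp (measurable_add_const _)
  have h3 : Measurable (fun x : EuclideanSpace ℝ (Fin n) => |f (x + h • z) - f x|) := by
    have := (h1.sub hf).norm
    exact this
  exact ((h3.div_const h).const_mul _).ennreal_ofReal

lemma heatJ_meas2 {n : ℕ} {f : EuclideanSpace ℝ (Fin n) → ℝ} (hf : Measurable f) (h : ℝ) :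
    Measurable (fun z : EuclideanSpace ℝ (Fin n) => ∫⁻ x : EuclideanSpace ℝ (Fin n),
      ENNReal.ofReal (gK n z * (|f (x + h • z) - f x| / h))) :=
  (heatJ_meas hf h).lintegral_prod_right'

/-- Fatou for the double integral. -/
lemma heatJ_fatou {n : ℕ} {f : ℕ → EuclideanSpace ℝ (Fin n) → ℝ} (hf : ∀ k, Measurable (f k))
    (h : ℕ → ℝ) (L : EuclideanSpace ℝ (Fin n) → EuclideanSpace ℝ (Fin n) → ENNReal)
    (hlim : ∀ z, ∀ᵐ x,
      Tendsto (fun k => ENNReal.ofReal (gK n z * (|f k (x + h k • z) - f k x| / h k))) atTop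
        (𝓝 (L z x))) :
    ∫⁻ z, ∫⁻ x, L z x ≤ liminf (fun k => heatJ (f k) (h k)) atTop := by
  have s1 : ∀ z, ∫⁻ x, L z x ≤ liminf (fun k => ∫⁻ x : EuclideanSpace ℝ (Fin n),
        ENNReal.ofReal (gK n z * (|f k (x + h k • z) - f k x| / h k))) atTop := by
    intro z
    calc ∫⁻ x, L z x = ∫⁻ x, liminf (fun k =>
          ENNReal.ofReal (gK n z * (|f k (x + h k • z) - f k x| / h k))) atTop := by
          apply lintegral_congr_ae
          filter_upwards [hlim z] with x hx
          exact hx.liminf_eq.symm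
      _ ≤ _ := lintegral_liminf_le fun k => heatJ_meas1 (hf k) (h k) z
  exact (lintegral_mono s1).trans (lintegral_liminf_le fun k => heatJ_meas2 (hf k) (h k))

lemma heat_limit_val {n : ℕ} {g : EuclideanSpace ℝ (Fin n) → ℝ} (hg : ContDiff ℝ 1 g) :
    ∫⁻ z : EuclideanSpace ℝ (Fin n), ∫⁻ x : EuclideanSpace ℝ (Fin n),
      ENNReal.ofReal (gK n z * |inner ℝ (gradient g x) z|)
      = ENNReal.ofReal (2 / Real.sqrt π) * ∫⁻ x, ‖gradient g x‖ₑ := by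
  have hc := gradient_cont hg
  have hk := gK_cont (n := n)
  rw [lintegral_lintegral_swap]
  · simp_rw [gauss_inner]
    rw [lintegral_const_mul' _ _ ENNReal.ofReal_ne_top]
  · apply Measurable.aemeasurable
    apply Measurable.ennreal_ofReal
    apply Continuous.measurable
    have h1 : Continuous (fun p : EuclideanSpace ℝ (Fin n) × EuclideanSpace ℝ (Fin n) =>
      inner ℝ (gradient g p.2) p.1) := (hc.comp continuous_snd).inner continuous_fst
    exact (hk.comp continuous_fst).mul h1.abs

lemma diff_le {n : ℕ} {g : EuclideanSpace ℝ (Fin n) → ℝ} (hg : ContDiff ℝ 1 g)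
    {h : ℝ} (hh : 0 < h) (z x : EuclideanSpace ℝ (Fin n)) :
    ENNReal.ofReal (|g (x + h • z) - g x| / h)
      ≤ ∫⁻ s in Set.Ioc (0 : ℝ) 1, ENNReal.ofReal |inner ℝ (gradient g (x + s • h • z)) z| := by
  have hc := gradient_cont hg
  have hcont : Continuous (fun s : ℝ => inner ℝ (gradient g (x + s • h • z)) z) := by
    have : Continuous (fun s : ℝ => gradient g (x + s • h • z)) := hc.comp (by fun_prop)
    exact this.inner continuous_const
  have hder : ∀ s : ℝ, HasDerivAt (fun s : ℝ => g (x + s • h • z))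
      (h * inner ℝ (gradient g (x + s • h • z)) z) s := by
    intro s
    have h1 : HasFDerivAt g (fderiv ℝ g (x + s • h • z)) (x + s • h • z) :=
      (hg.differentiable (by norm_num) _).hasFDerivAt
    have h2 : HasDerivAt (fun s : ℝ => x + s • h • z) (h • z) s := by
      simpa using ((hasDerivAt_id s).smul_const (h • z)).const_add x
    have h3 := h1.comp_hasDerivAt s h2
    have h4 : fderiv ℝ g (x + s • h • z) (h • z)
        = h * inner ℝ (gradient g (x + s • h • z)) z := by
      rw [inner_gradient', map_smul, smul_eq_mul]
    rw [h4] at h3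
    exact h3
  have hftc : g (x + h • z) - g x
      = h * ∫ s in Set.Ioc (0 : ℝ) 1, inner ℝ (gradient g (x + s • h • z)) z := by
    have := intervalIntegral.integral_eq_sub_of_hasDerivAt (a := 0) (b := 1)
      (fun s _ => hder s) ((continuous_const.mul hcont).intervalIntegrable _ _)
    rw [intervalIntegral.integral_const_mul,
      intervalIntegral.integral_of_le zero_le_one] at this
    simp only [one_smul, zero_smul, add_zero] at this
    exact this.symm
  rw [hftc, abs_mul, abs_of_pos hh, mul_div_cancel_left₀ _ hh.ne']
  have e : ∀ r : ℝ, ENNReal.ofReal |r| = ‖r‖ₑ := fun r => by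
    rw [← ofReal_norm, Real.norm_eq_abs]
  simp_rw [e]
  exact enorm_integral_le_lintegral_enorm _

lemma heatJ_le_smooth {n : ℕ} {g : EuclideanSpace ℝ (Fin n) → ℝ} (hg : ContDiff ℝ 1 g)
    {h : ℝ} (hh : 0 < h) :
    heatJ g h ≤ ENNReal.ofReal (2 / Real.sqrt π) * ∫⁻ x, ‖gradient g x‖ₑ := by
  rw [← heat_limit_val hg]
  have hc := gradient_cont hg
  apply lintegral_mono
  intro z
  simp only [ENNReal.ofReal_mul (gK_nonneg z)]
  rw [lintegral_const_mul' _ _ ENNReal.ofReal_ne_top, lintegral_const_mul' _ _ ENNReal.ofReal_ne_top]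
  refine mul_le_mul_right ?_ _
  calc ∫⁻ x, ENNReal.ofReal (|g (x + h • z) - g x| / h)
      ≤ ∫⁻ x, ∫⁻ s in Set.Ioc (0 : ℝ) 1,
          ENNReal.ofReal |inner ℝ (gradient g (x + s • h • z)) z| :=
        lintegral_mono fun x => diff_le hg hh z x
    _ = ∫⁻ s in Set.Ioc (0 : ℝ) 1, ∫⁻ x,
          ENNReal.ofReal |inner ℝ (gradient g (x + s • h • z)) z| := by
        apply lintegral_lintegral_swap
        apply Measurable.aemeasurable
        apply Measurable.ennreal_ofReal
        apply Continuous.measurable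
        have h1 : Continuous (fun p : EuclideanSpace ℝ (Fin n) × ℝ =>
          gradient g (p.1 + p.2 • h • z)) := hc.comp (by fun_prop)
        exact (h1.inner continuous_const).abs
    _ = ∫⁻ s in Set.Ioc (0 : ℝ) 1, ∫⁻ x, ENNReal.ofReal |inner ℝ (gradient g x) z| := by
        apply lintegral_congr
        intro s
        exact lintegral_add_right_eq_self
          (fun x => ENNReal.ofReal |inner ℝ (gradient g x) z|) (s • h • z)
    _ = ∫⁻ x, ENNReal.ofReal |inner ℝ (gradient g x) z| := by simp

lemma heatJ_ge_smooth {n : ℕ} {g : EuclideanSpace ℝ (Fin n) → ℝ} (hg : ContDiff ℝ 1 g)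
    {h : ℕ → ℝ} (hh : ∀ k, 0 < h k) (h0 : Tendsto h atTop (𝓝 0)) :
    ENNReal.ofReal (2 / Real.sqrt π) * ∫⁻ x, ‖gradient g x‖ₑ
      ≤ liminf (fun k => heatJ g (h k)) atTop := by
  rw [← heat_limit_val hg]
  have hgm : Measurable g := hg.continuous.measurable
  have hlim : ∀ z x : EuclideanSpace ℝ (Fin n),
      Tendsto (fun k => ENNReal.ofReal (gK n z * (|g (x + h k • z) - g x| / h k))) atTop
        (𝓝 (ENNReal.ofReal (gK n z * |inner ℝ (gradient g x) z|))) := by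
    intro z x
    apply ENNReal.tendsto_ofReal
    apply Tendsto.const_mul
    have h1 : HasFDerivAt g (fderiv ℝ g x) x := (hg.differentiable (by norm_num) _).hasFDerivAt
    have h2 := (h1.hasLineDerivAt z).tendsto_slope_zero
    have h3 : Tendsto h atTop (𝓝[≠] 0) :=
      tendsto_nhdsWithin_iff.2 ⟨h0, Eventually.of_forall fun k => (hh k).ne'⟩
    have h4 := (h2.comp h3).abs
    rw [← inner_gradient'] at h4
    refine h4.congr fun k => ?_
    simp only [Function.comp, smul_eq_mul, abs_mul, abs_inv, abs_of_pos (hh k)]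
    ring
  exact heatJ_fatou (fun _ => hgm) h _ (fun z => Eventually.of_forall fun x => hlim z x)

/-- Mollification of `f` by a normalized bump function. -/
noncomputable def moll {n : ℕ} (ρ : ContDiffBump (0 : EuclideanSpace ℝ (Fin n)))
    (f : EuclideanSpace ℝ (Fin n) → ℝ) (x : EuclideanSpace ℝ (Fin n)) : ℝ :=
  ∫ w, ρ.normed volume w * f (x - w)

lemma moll_eq {n : ℕ} (ρ : ContDiffBump (0 : EuclideanSpace ℝ (Fin n)))
    (f : EuclideanSpace ℝ (Fin n) → ℝ) :
    moll ρ f = MeasureTheory.convolution (ρ.normed volume) f (ContinuousLinearMap.lsmul ℝ ℝ)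
      volume := by
  ext x; rfl

lemma moll_contDiff {n : ℕ} (ρ : ContDiffBump (0 : EuclideanSpace ℝ (Fin n)))
    {f : EuclideanSpace ℝ (Fin n) → ℝ} (hf : Integrable f) : ContDiff ℝ 2 (moll ρ f) := by
  rw [moll_eq]
  exact ρ.hasCompactSupport_normed.contDiff_convolution_left (n := 2) _ ρ.contDiff_normed
    hf.locallyIntegrable

lemma moll_integrable {n : ℕ} (ρ : ContDiffBump (0 : EuclideanSpace ℝ (Fin n)))
    {f : EuclideanSpace ℝ (Fin n) → ℝ} (hf : Integrable f) (x : EuclideanSpace ℝ (Fin n)) :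
    Integrable (fun w => ρ.normed volume w * f (x - w)) :=
  ρ.hasCompactSupport_normed.convolutionExists_left (ContinuousLinearMap.lsmul ℝ ℝ)
    ρ.continuous_normed hf.locallyIntegrable x

lemma heatJ_moll_le {n : ℕ} (ρ : ContDiffBump (0 : EuclideanSpace ℝ (Fin n)))
    {f : EuclideanSpace ℝ (Fin n) → ℝ} (hf : Integrable f) (hm : Measurable f)
    {h : ℝ} (hh : 0 < h) : heatJ (moll ρ f) h ≤ heatJ f h := by
  apply lintegral_mono
  intro z
  set r : EuclideanSpace ℝ (Fin n) → ℝ := ρ.normed volume with hr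
  have hr0 : ∀ w, 0 ≤ r w := ρ.nonneg_normed
  have hrm : Measurable r := ρ.continuous_normed.measurable
  have hD : Measurable (fun x => f (x + h • z) - f x) := (hm.comp (measurable_add_const _)).sub hm
  set D : EuclideanSpace ℝ (Fin n) → ℝ := fun x => f (x + h • z) - f x with hDdef
  have hpt : ∀ x, ‖moll ρ f (x + h • z) - moll ρ f x‖ₑ ≤ ∫⁻ w, ‖r w‖ₑ * ‖D (x - w)‖ₑ := by
    intro x
    unfold moll
    rw [← integral_sub (moll_integrable ρ hf _) (moll_integrable ρ hf _)]
    refine (enorm_integral_le_lintegral_enorm _).trans (lintegral_mono fun w => ?_)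
    rw [← mul_sub, enorm_mul, show x + h • z - w = x - w + h • z by abel]
  have hint : ∫⁻ x, ‖moll ρ f (x + h • z) - moll ρ f x‖ₑ ≤ ∫⁻ x, ‖D x‖ₑ := by
    calc _ ≤ ∫⁻ x, ∫⁻ w, ‖r w‖ₑ * ‖D (x - w)‖ₑ := lintegral_mono hpt
      _ = ∫⁻ w, ∫⁻ x, ‖r w‖ₑ * ‖D (x - w)‖ₑ := by
        apply lintegral_lintegral_swap
        apply Measurable.aemeasurable
        exact (hrm.comp measurable_snd).enorm.mul
          (hD.comp (measurable_fst.sub measurable_snd)).enorm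
      _ = ∫⁻ w, ‖r w‖ₑ * ∫⁻ x, ‖D x‖ₑ := by
        apply lintegral_congr; intro w
        rw [lintegral_const_mul' _ _ enorm_ne_top]
        congr 1
        exact lintegral_sub_right_eq_self (fun x => ‖D x‖ₑ) w
      _ = (∫⁻ w, ‖r w‖ₑ) * ∫⁻ x, ‖D x‖ₑ := lintegral_mul_const _ hrm.enorm
      _ = _ := by
        have : ∫⁻ w, ‖r w‖ₑ = 1 := by
          have e : ∀ w, ‖r w‖ₑ = ENNReal.ofReal (r w) := fun w => Real.enorm_of_nonneg (hr0 w)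
          simp_rw [e]
          rw [← ofReal_integral_eq_lintegral_ofReal ρ.integrable_normed
            (Eventually.of_forall hr0), ρ.integral_normed, ENNReal.ofReal_one]
        rw [this, one_mul]
  have e : ∀ d : ℝ, ENNReal.ofReal (gK n z * (|d| / h)) = ENNReal.ofReal (gK n z / h) * ‖d‖ₑ := by
    intro d
    rw [← ofReal_norm, Real.norm_eq_abs,
      ← ENNReal.ofReal_mul (div_nonneg (gK_nonneg z) hh.le)]
    congr 1; ring
  simp_rw [e]
  rw [lintegral_const_mul' _ _ ENNReal.ofReal_ne_top, lintegral_const_mul' _ _ ENNReal.ofReal_ne_top]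
  exact mul_le_mul_right hint _

lemma phi_cont {n : ℕ} {f : EuclideanSpace ℝ (Fin n) → ℝ} (hf : Integrable f)
    {u : EuclideanSpace ℝ (Fin n) → ℝ} (hu : Continuous u) (hc : HasCompactSupport u) :
    Continuous (fun w => ∫ x, f x * u (x + w)) := by
  obtain ⟨C, hC⟩ := hc.exists_bound_of_continuous hu
  apply continuous_of_dominated (bound := fun x => ‖f x‖ * C)
  · intro w
    exact hf.1.mul (hu.comp (by fun_prop)).aestronglyMeasurable
  · intro w
    filter_upwards with x
    rw [norm_mul]
    exact mul_le_mul_of_nonneg_left (hC _) (norm_nonneg _)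
  · exact hf.norm.mul_const C
  · filter_upwards with x
    exact continuous_const.mul (hu.comp (by fun_prop))

lemma moll_pair {n : ℕ} (ρ : ContDiffBump (0 : EuclideanSpace ℝ (Fin n)))
    {f : EuclideanSpace ℝ (Fin n) → ℝ} (hf : Integrable f)
    {u : EuclideanSpace ℝ (Fin n) → ℝ} (hu : Continuous u) (hc : HasCompactSupport u) :
    ∫ x, moll ρ f x * u x = ∫ w, ρ.normed volume w * ∫ x, f x * u (x + w) := by
  obtain ⟨C, hC⟩ := hc.exists_bound_of_continuous hu
  have hI : Integrable (fun p : EuclideanSpace ℝ (Fin n) × EuclideanSpace ℝ (Fin n) =>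
      (ρ.normed volume p.2 * f (p.1 - p.2)) * u p.1) (volume.prod volume) := by
    have h1 := Integrable.convolution_integrand (ContinuousLinearMap.lsmul ℝ ℝ)
      (ρ.integrable_normed (μ := volume)) hf
    refine Integrable.mul_bdd (c := C) h1 ?_ ?_
    · exact (hu.comp continuous_fst).aestronglyMeasurable
    · exact Eventually.of_forall fun p => hC _
  calc ∫ x, moll ρ f x * u x = ∫ x, ∫ w, (ρ.normed volume w * f (x - w)) * u x := by
        congr 1; ext x; rw [integral_mul_const]; rfl
    _ = ∫ w, ∫ x, (ρ.normed volume w * f (x - w)) * u x := integral_integral_swap hI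
    _ = _ := by
        congr 1; ext w
        simp_rw [mul_assoc]
        rw [integral_const_mul]
        congr 1
        rw [← integral_add_right_eq_self (fun x => f (x - w) * u x) w]
        simp

lemma moll_test_le {n : ℕ} (ρ : ContDiffBump (0 : EuclideanSpace ℝ (Fin n)))
    {f : EuclideanSpace ℝ (Fin n) → ℝ} (hf : Integrable f) (hBV : BddAbove (divTestVals f))
    {φ : EuclideanSpace ℝ (Fin n) → EuclideanSpace ℝ (Fin n)}
    (hφ : ContDiff ℝ 1 φ) (hc : HasCompactSupport φ) (h1 : ∀ x, ‖φ x‖ ≤ 1) :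
    ∫ x, moll ρ f x * eucDiv φ x ≤ totalVar f := by
  have hu := eucDiv_cont hφ
  have huc := eucDiv_supp hc
  rw [moll_pair ρ hf hu huc]
  have hle : ∀ w, ∫ x, f x * eucDiv φ (x + w) ≤ totalVar f := by
    intro w
    apply le_csSup hBV
    refine ⟨fun x => φ (x + w), hφ.comp (contDiff_id.add contDiff_const), ?_, fun x => h1 _, ?_⟩
    · exact hc.comp_homeomorph (Homeomorph.addRight w)
    · congr 1; ext x
      simp only [eucDiv, fderiv_comp_add_right]
  have hphi := phi_cont hf hu huc
  calc _ ≤ ∫ w, ρ.normed volume w * totalVar f := by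
        apply integral_mono
        · apply (ρ.continuous_normed.mul hphi).integrable_of_hasCompactSupport
          exact ρ.hasCompactSupport_normed.mul_right
        · exact ρ.integrable_normed.mul_const _
        · intro w
          exact mul_le_mul_of_nonneg_left (hle w) (ρ.nonneg_normed w)
    _ = totalVar f := by rw [integral_mul_const, ρ.integral_normed, one_mul]

lemma moll_test_tendsto {n : ℕ} {ρ : ℕ → ContDiffBump (0 : EuclideanSpace ℝ (Fin n))}
    (hρ : Tendsto (fun k => (ρ k).rOut) atTop (𝓝 0))
    {f : EuclideanSpace ℝ (Fin n) → ℝ} (hf : Integrable f)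
    {u : EuclideanSpace ℝ (Fin n) → ℝ} (hu : Continuous u) (hc : HasCompactSupport u) :
    Tendsto (fun k => ∫ x, moll (ρ k) f x * u x) atTop (𝓝 (∫ x, f x * u x)) := by
  have hphi := phi_cont hf hu hc
  have := ContDiffBump.convolution_tendsto_right_of_continuous (μ := volume) hρ
    (hphi.comp continuous_neg) 0
  simp only [Function.comp, neg_zero, add_zero] at this
  refine this.congr fun k => ?_
  rw [moll_pair (ρ k) hf hu hc]
  simp [MeasureTheory.convolution]

/-- A concrete sequence of bump functions shrinking to the origin. -/
noncomputable def bumpSeq (n k : ℕ) : ContDiffBump (0 : EuclideanSpace ℝ (Fin n)) :=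
  ⟨1 / ((k : ℝ) + 1), 2 * (1 / ((k : ℝ) + 1)), by positivity, by
    have : 0 < 1 / ((k : ℝ) + 1) := by positivity
    linarith⟩

lemma bumpSeq_rOut (n : ℕ) : Tendsto (fun k => (bumpSeq n k).rOut) atTop (𝓝 0) := by
  have : Tendsto (fun k : ℕ => 2 * (1 / ((k : ℝ) + 1))) atTop (𝓝 (2 * 0)) :=
    tendsto_one_div_add_atTop_nhds_zero_nat.const_mul 2
  simpa [bumpSeq] using this

lemma heatJ_le {n : ℕ} {f : EuclideanSpace ℝ (Fin n) → ℝ} (hf : Integrable f)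
    (hBV : BddAbove (divTestVals f)) {h : ℝ} (hh : 0 < h) :
    heatJ f h ≤ ENNReal.ofReal (2 / Real.sqrt π) * ENNReal.ofReal (totalVar f) := by
  have hae : ∀ᵐ x, Tendsto (fun k => moll (bumpSeq n k) f x) atTop (𝓝 (f x)) := by
    have := ContDiffBump.ae_convolution_tendsto_right_of_locallyIntegrable (μ := volume) (K := 2)
      (bumpSeq_rOut n) (Eventually.of_forall fun k => le_of_eq rfl) hf.locallyIntegrable
    simpa only [moll_eq] using this
  have hfat : heatJ f h ≤ liminf (fun k => heatJ (moll (bumpSeq n k) f) h) atTop := by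
    refine heatJ_fatou (f := fun k => moll (bumpSeq n k) f)
      (fun k => (moll_contDiff _ hf).continuous.measurable) (fun _ => h) _ ?_
    intro z
    have h2 : ∀ᵐ x, Tendsto (fun k => moll (bumpSeq n k) f (x + h • z)) atTop
        (𝓝 (f (x + h • z))) :=
      (measurePreserving_add_right volume (h • z)).quasiMeasurePreserving.ae hae
    filter_upwards [hae, h2] with x hx1 hx2
    apply ENNReal.tendsto_ofReal
    exact (((hx2.sub hx1).abs).div_const h).const_mul _
  refine hfat.trans ?_
  refine liminf_le_of_frequently_le' (Eventually.frequently (Eventually.of_forall fun k => ?_))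
  have hC := moll_contDiff (bumpSeq n k) hf
  refine (heatJ_le_smooth (hC.of_le (by norm_num)) hh).trans ?_
  refine mul_le_mul_right ?_ _
  exact grad_le_of_test hC fun φ a b c => moll_test_le _ hf hBV a b c

lemma heatJ_ge {n : ℕ} {f : EuclideanSpace ℝ (Fin n) → ℝ} (hf : Integrable f) (hm : Measurable f)
    {h : ℕ → ℝ} (hh : ∀ k, 0 < h k) (h0 : Tendsto h atTop (𝓝 0)) :
    ENNReal.ofReal (2 / Real.sqrt π) * ENNReal.ofReal (totalVar f)
      ≤ liminf (fun k => heatJ f (h k)) atTop := by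
  have hc : 0 < 2 / Real.sqrt π := by positivity
  have key : ∀ a ∈ divTestVals f, ENNReal.ofReal (2 / Real.sqrt π) * ENNReal.ofReal a
      ≤ liminf (fun k => heatJ f (h k)) atTop := by
    rintro a ⟨φ, hφ, hcs, h1, rfl⟩
    have ht := moll_test_tendsto (bumpSeq_rOut n) hf (eucDiv_cont hφ) (eucDiv_supp hcs)
    have ht2 := ENNReal.Tendsto.const_mul (a := ENNReal.ofReal (2 / Real.sqrt π))
      (ENNReal.tendsto_ofReal ht) (Or.inr ENNReal.ofReal_ne_top)
    refine le_of_tendsto ht2 (Eventually.of_forall fun j => ?_)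
    have hC : ContDiff ℝ 1 (moll (bumpSeq n j) f) := (moll_contDiff _ hf).of_le (by norm_num)
    refine (mul_le_mul_right (test_le_grad hC hφ hcs h1) _).trans ?_
    refine (heatJ_ge_smooth hC hh h0).trans ?_
    exact liminf_le_liminf (Eventually.of_forall fun k => heatJ_moll_le _ hf hm (hh k))
  by_cases htop : liminf (fun k => heatJ f (h k)) atTop = ⊤
  · rw [htop]; exact le_top
  rw [← ENNReal.ofReal_mul hc.le]
  rw [← ENNReal.ofReal_toReal htop]
  apply ENNReal.ofReal_le_ofReal
  rw [← le_div_iff₀' hc]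
  apply csSup_le
  · exact ⟨_, 0, contDiff_const, HasCompactSupport.zero, by simp, rfl⟩
  · intro a ha
    rw [le_div_iff₀' hc]
    have := key a ha
    rw [← ENNReal.ofReal_mul hc.le, ← ENNReal.ofReal_toReal htop] at this
    exact (ENNReal.ofReal_le_ofReal_iff ENNReal.toReal_nonneg).1 this

lemma inner_rescale {n : ℕ} (f : EuclideanSpace ℝ (Fin n) → ℝ) {t : ℝ} (ht : 0 < t)
    (x : EuclideanSpace ℝ (Fin n)) :
    (1 / Real.sqrt t) * ∫ y : EuclideanSpace ℝ (Fin n),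
            |f x - f y| * ((4 * π * t) ^ (-(n : ℝ) / 2)
              * Real.exp (-‖x - y‖ ^ 2 / (4 * t)))
      = ∫ z : EuclideanSpace ℝ (Fin n),
        gK n z * (|f (x + Real.sqrt t • z) - f x| / Real.sqrt t) := by
  have hh : 0 < Real.sqrt t := Real.sqrt_pos.2 ht
  set h := Real.sqrt t with hdef
  have hht : h ^ 2 = t := Real.sq_sqrt ht.le
  rw [← integral_add_left_eq_self _ x]
  have hsm := Measure.integral_comp_smul (volume : Measure (EuclideanSpace ℝ (Fin n)))
    (fun w => |f x - f (x + w)| * ((4 * π * t) ^ (-(n : ℝ) / 2)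
              * Real.exp (-‖x - (x + w)‖ ^ 2 / (4 * t)))) h
  have hp : 0 < h ^ n := by positivity
  rw [finrank_euclideanSpace_fin, abs_of_pos (inv_pos.2 hp), smul_eq_mul,
    eq_inv_mul_iff_mul_eq₀ hp.ne'] at hsm
  rw [← hsm, ← mul_assoc, ← integral_const_mul]
  congr 1; ext z
  have e1 : (4 * π * t) ^ (-(n : ℝ) / 2) * h ^ n = (4 * π) ^ (-(n : ℝ) / 2) := by
    rw [Real.mul_rpow (by positivity) ht.le, mul_assoc]
    have : t ^ (-(n : ℝ) / 2) * h ^ n = 1 := by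
      rw [hdef, Real.sqrt_eq_rpow, ← Real.rpow_natCast, ← Real.rpow_mul ht.le,
        ← Real.rpow_add ht]
      ring_nf; simp
    rw [this, mul_one]
  have e2 : -‖x - (x + h • z)‖ ^ 2 / (4 * t) = -‖z‖ ^ 2 / 4 := by
    rw [sub_add_cancel_left, norm_neg, norm_smul, Real.norm_eq_abs, abs_of_pos hh, mul_pow, hht]
    field_simp
  rw [e2, abs_sub_comm]
  unfold gK
  rw [← e1]
  ring

lemma heat_eq_toReal {n : ℕ} {f : EuclideanSpace ℝ (Fin n) → ℝ} (hm : Measurable f)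
    {t : ℝ} (ht : 0 < t) (hfin : heatJ f (Real.sqrt t) ≠ ⊤) :
    (1 / Real.sqrt t) *
          ∫ x : EuclideanSpace ℝ (Fin n), ∫ y : EuclideanSpace ℝ (Fin n),
            |f x - f y| * ((4 * π * t) ^ (-(n : ℝ) / 2)
              * Real.exp (-‖x - y‖ ^ 2 / (4 * t)))
      = (heatJ f (Real.sqrt t)).toReal := by
  have hh : 0 < Real.sqrt t := Real.sqrt_pos.2 ht
  rw [← integral_const_mul]
  simp_rw [inner_rescale f ht]
  set h := Real.sqrt t with hdef
  have hJ := heatJ_meas hm h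
  have hsw : heatJ f h = ∫⁻ x : EuclideanSpace ℝ (Fin n), ∫⁻ z : EuclideanSpace ℝ (Fin n),
      ENNReal.ofReal (gK n z * (|f (x + h • z) - f x| / h)) :=
    lintegral_lintegral_swap hJ.aemeasurable
  have hLm : Measurable (fun x : EuclideanSpace ℝ (Fin n) => ∫⁻ z : EuclideanSpace ℝ (Fin n),
      ENNReal.ofReal (gK n z * (|f (x + h • z) - f x| / h))) := hJ.lintegral_prod_left'
  have hin : ∀ x, ∫ z : EuclideanSpace ℝ (Fin n), gK n z * (|f (x + h • z) - f x| / h)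
      = (∫⁻ z : EuclideanSpace ℝ (Fin n),
        ENNReal.ofReal (gK n z * (|f (x + h • z) - f x| / h))).toReal := by
    intro x
    rw [integral_eq_lintegral_of_nonneg_ae]
    · filter_upwards with z
      exact mul_nonneg (gK_nonneg z) (div_nonneg (abs_nonneg _) hh.le)
    · have h1 : Measurable (fun z : EuclideanSpace ℝ (Fin n) => f (x + h • z)) :=
        hm.comp (by fun_prop)
      have h3 : Measurable (fun z : EuclideanSpace ℝ (Fin n) => |f (x + h • z) - f x|) := by
        have := (h1.sub_const (f x)).norm
        exact this
      exact (gK_cont.measurable.mul (h3.div_const h)).aestronglyMeasurable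
  simp_rw [hin]
  rw [integral_toReal hLm.aemeasurable, hsw]
  rw [hsw] at hfin
  exact ae_lt_top hLm hfin

lemma main_measurable (n : ℕ)
    (f : EuclideanSpace ℝ (Fin n) → ℝ) (hf : Integrable f volume) (hm : Measurable f)
    (hBV : BddAbove (divTestVals f)) :
    Tendsto (fun t : ℝ =>
        (1 / Real.sqrt t) *
          ∫ x : EuclideanSpace ℝ (Fin n), ∫ y : EuclideanSpace ℝ (Fin n),
            |f x - f y| * ((4 * π * t) ^ (-(n : ℝ) / 2)
              * Real.exp (-‖x - y‖ ^ 2 / (4 * t))))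
      (𝓝[>] 0) (𝓝 (2 / Real.sqrt π * totalVar f)) := by
  have hV0 : 0 ≤ totalVar f := by
    apply le_csSup hBV
    refine ⟨0, contDiff_const, HasCompactSupport.zero, by simp, ?_⟩
    simp [eucDiv]
  have hc : 0 < 2 / Real.sqrt π := by positivity
  set A : ENNReal := ENNReal.ofReal (2 / Real.sqrt π) * ENNReal.ofReal (totalVar f) with hA
  have hAtop : A ≠ ⊤ := ENNReal.mul_ne_top ENNReal.ofReal_ne_top ENNReal.ofReal_ne_top
  have hAr : A.toReal = 2 / Real.sqrt π * totalVar f := by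
    rw [hA, ENNReal.toReal_mul, ENNReal.toReal_ofReal hc.le, ENNReal.toReal_ofReal hV0]
  have hle : ∀ h, 0 < h → heatJ f h ≤ A := fun h hh => heatJ_le hf hBV hh
  rw [← hAr]
  have hT : Tendsto (fun t : ℝ => heatJ f (Real.sqrt t)) (𝓝[>] 0) (𝓝 A) := by
    apply tendsto_of_seq_tendsto
    intro s hs
    rw [tendsto_nhdsWithin_iff] at hs
    obtain ⟨hs0, hspos⟩ := hs
    -- modify the sequence on finitely many terms to be positive
    let s' : ℕ → ℝ := fun k => if 0 < s k then Real.sqrt (s k) else 1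
    have hs'pos : ∀ k, 0 < s' k := by
      intro k; simp only [s']; split_ifs with h
      · exact Real.sqrt_pos.2 h
      · exact one_pos
    have hss : ∀ᶠ k in atTop, s' k = Real.sqrt (s k) := by
      filter_upwards [hspos] with k hk
      have hk' : 0 < s k := hk
      simp [s', hk']
    have hs'0 : Tendsto s' atTop (𝓝 0) := by
      have : Tendsto (fun k => Real.sqrt (s k)) atTop (𝓝 (Real.sqrt 0)) :=
        (Real.continuous_sqrt.tendsto 0).comp hs0
      rw [Real.sqrt_zero] at this
      exact this.congr' (hss.mono fun k hk => hk.symm)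
    have h1 : Tendsto (fun k => heatJ f (s' k)) atTop (𝓝 A) := by
      refine tendsto_of_le_liminf_of_limsup_le ?_ ?_
      · exact heatJ_ge hf hm hs'pos hs'0
      · exact limsup_le_of_le (by isBoundedDefault)
          (Eventually.of_forall fun k => hle _ (hs'pos k))
    exact h1.congr' (hss.mono fun k hk => by simp only [hk, Function.comp])
  have hT2 := (ENNReal.tendsto_toReal hAtop).comp hT
  refine hT2.congr' ?_
  filter_upwards [self_mem_nhdsWithin] with t ht
  have ht' : 0 < t := ht
  exact (heat_eq_toReal hm ht'
    (ne_top_of_le_ne_top hAtop (hle _ (Real.sqrt_pos.2 ht')))).symm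

/-- Euclidean model case of the main theorem: if `f ∈ L¹(ℝⁿ) ∩ BV(ℝⁿ)`, then
`(1/√t) ∫∫ |f(x)-f(y)| (4πt)^{-n/2} e^{-|x-y|²/(4t)} dy dx → (2/√π)|Df|(ℝⁿ)`
as `t → 0⁺`. -/
theorem heat_semigroup_BV_characterization (n : ℕ) (hn : 1 ≤ n)
    (f : EuclideanSpace ℝ (Fin n) → ℝ) (hf : Integrable f volume)
    (hBV : BddAbove (divTestVals f)) :
    Tendsto (fun t : ℝ =>
        (1 / Real.sqrt t) *
          ∫ x : EuclideanSpace ℝ (Fin n), ∫ y : EuclideanSpace ℝ (Fin n),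
            |f x - f y| * ((4 * π * t) ^ (-(n : ℝ) / 2)
              * Real.exp (-‖x - y‖ ^ 2 / (4 * t))))
      (𝓝[>] 0) (𝓝 (2 / Real.sqrt π * totalVar f)) := by
  have hm : Measurable (hf.1.mk f) := hf.1.stronglyMeasurable_mk.measurable
  have hae : f =ᵐ[volume] hf.1.mk f := hf.1.ae_eq_mk
  set g := hf.1.mk f with hg
  have hdt : divTestVals f = divTestVals g := by
    have e : ∀ φ : EuclideanSpace ℝ (Fin n) → EuclideanSpace ℝ (Fin n),
        ∫ x, f x * eucDiv φ x = ∫ x, g x * eucDiv φ x := by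
      intro φ
      apply integral_congr_ae
      filter_upwards [hae] with x hx
      rw [hx]
    unfold divTestVals
    simp_rw [e]
  have htv : totalVar f = totalVar g := by unfold totalVar; rw [hdt]
  rw [htv]
  rw [hdt] at hBV
  refine (main_measurable n g (hf.congr hae) hm hBV).congr fun t => ?_
  congr 1
  apply integral_congr_ae
  filter_upwards [hae] with x hx
  apply integral_congr_ae
  filter_upwards [hae] with y hy
  rw [hx, hy]
end

section
/- Let f : ℝⁿ → ℝ be Lipschitz with compact support. Then for every t > 0, (1/√t) ∫_{ℝⁿ} ∫_{ℝⁿ} |f(x) − f(y)| (4πt)^{-n/2} e^{-|x−y|²/(4t)} dy dx ≤ (2/√π) Lip(f) · |supp_t|, and more precisely the limsup as t → 0⁺ is at most (2/√π) ∫_{ℝⁿ} |∇f| dx. -/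
open Real MeasureTheory Filter Topology

lemma aux_abs_integral {b : ℝ} (hb : 0 < b) :
    ∫ x : ℝ, |x| * Real.exp (-b * x ^ 2) = 1 / b := by
  have h1 := integral_comp_abs (f := fun x : ℝ => x * Real.exp (-b * x ^ 2))
  simp only [sq_abs] at h1
  rw [h1]
  have h2 := integral_rpow_mul_exp_neg_mul_rpow (p := 2) (q := 1) (b := b)
    (by norm_num) (by norm_num) hb
  have h3 : ∫ x in Set.Ioi (0 : ℝ), x * Real.exp (-b * x ^ 2)
      = ∫ x in Set.Ioi (0 : ℝ), x ^ (1 : ℝ) * Real.exp (-b * x ^ (2 : ℝ)) := by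
    simp
  rw [h3, h2]
  have : ((1 : ℝ) + 1) / 2 = 1 := by norm_num
  rw [neg_div, this, Real.Gamma_one, Real.rpow_neg_one]
  field_simp

lemma aux_abs_integrable {b : ℝ} (hb : 0 < b) :
    Integrable (fun x : ℝ => |x| * Real.exp (-b * x ^ 2)) := by
  by_contra h
  have := aux_abs_integral hb
  rw [integral_undef h] at this
  have : 0 < 1 / b := by positivity
  linarith

/-- The first absolute moment in a coordinate direction. -/
lemma aux_coord (n : ℕ) (i0 : Fin n) {t : ℝ} (ht : 0 < t) :
    ∫⁻ z : EuclideanSpace ℝ (Fin n), ENNReal.ofReal (|z i0| *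
      ((4 * π * t) ^ (-(n : ℝ) / 2) * Real.exp (-‖z‖ ^ 2 / (4 * t))))
      = ENNReal.ofReal (2 * Real.sqrt t / Real.sqrt π) := by
  set b : ℝ := 1 / (4 * t) with hb
  have hb0 : 0 < b := by positivity
  let F : Fin n → ℝ → ℝ := fun i x => (if i = i0 then |x| else 1) * Real.exp (-b * x ^ 2)
  have hFi : ∀ i, Integrable (F i) := by
    intro i
    by_cases h : i = i0
    · simpa [F, h] using aux_abs_integrable hb0
    · simpa [F, h] using integrable_exp_neg_mul_sq hb0
  have hFv : ∀ i, ∫ x, F i x = if i = i0 then 1 / b else √(π / b) := by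
    intro i
    by_cases h : i = i0
    · simpa [F, h] using aux_abs_integral hb0
    · simpa [F, h] using integral_gaussian b
  have hint : Integrable (fun x : Fin n → ℝ => ∏ i, F i (x i)) := by
    rw [volume_pi]; exact Integrable.fintype_prod hFi
  have hval := integral_fintype_prod_volume_eq_prod (𝕜 := ℝ) F
  simp only [hFv] at hval
  have hpt : ∀ z : Fin n → ℝ, |z i0| * Real.exp (-‖WithLp.toLp 2 z‖ ^ 2 / (4 * t))
      = ∏ i, F i (z i) := by
    intro z
    simp only [F, Finset.prod_mul_distrib, Finset.prod_ite_eq', Finset.mem_univ, if_true,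
      ← Real.exp_sum]
    congr 2
    rw [EuclideanSpace.norm_sq_eq, ← Finset.mul_sum, hb]
    simp only [Real.norm_eq_abs, sq_abs]
    ring
  rw [← (PiLp.volume_preserving_toLp (Fin n)).lintegral_comp_emb
    (MeasurableEquiv.toLp 2 (Fin n → ℝ)).measurableEmbedding]
  have hpt2 : ∀ z : Fin n → ℝ, ENNReal.ofReal (|z i0| *
      ((4 * π * t) ^ (-(n : ℝ) / 2) * Real.exp (-‖WithLp.toLp 2 z‖ ^ 2 / (4 * t))))
      = ENNReal.ofReal ((4 * π * t) ^ (-(n : ℝ) / 2) * ∏ i, F i (z i)) := by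
    intro z; rw [← hpt]; congr 1; ring
  simp only [hpt2]
  rw [← ofReal_integral_eq_lintegral_ofReal (hint.const_mul _), integral_const_mul, hval]
  · congr 1
    have hcard : (Finset.univ.erase i0).card = n - 1 := by simp
    rw [← Finset.mul_prod_erase _ _ (Finset.mem_univ i0), if_pos rfl,
      Finset.prod_congr rfl (g := fun _ => √(π / b)), Finset.prod_const, hcard]
    · have hn : 1 ≤ n := i0.pos
      have e1 : π / b = 4 * π * t := by rw [hb]; field_simp
      have hp : 0 < 4 * π * t := by positivity
      rw [e1, Real.sqrt_eq_rpow, ← Real.rpow_natCast, ← Real.rpow_mul hp.le, Nat.cast_sub hn, hb]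
      rw [mul_left_comm, ← Real.rpow_add hp]
      have e2 : -(n : ℝ) / 2 + 1 / 2 * ((n : ℝ) - (1 : ℕ)) = - (1 / 2) := by push_cast; ring
      rw [e2, Real.rpow_neg hp.le, ← Real.sqrt_eq_rpow]
      have e3 : 4 * π * t = (2 * √π * √t) ^ 2 := by
        rw [mul_pow, mul_pow, Real.sq_sqrt pi_pos.le, Real.sq_sqrt ht.le]; norm_num
      rw [e3, Real.sqrt_sq (by positivity)]
      have := Real.sq_sqrt ht.le
      have h1 : √t ≠ 0 := by positivity
      have h2 : √π ≠ 0 := by positivity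
      field_simp
      nlinarith
    · intro i hi
      rw [if_neg (Finset.ne_of_mem_erase hi)]
  · refine Eventually.of_forall fun z => ?_
    dsimp only [Pi.zero_apply]
    rw [← hpt]
    positivity

lemma aux_moment (n : ℕ) (D : EuclideanSpace ℝ (Fin n) →L[ℝ] ℝ) {t : ℝ} (ht : 0 < t) :
    ∫⁻ z : EuclideanSpace ℝ (Fin n), ‖D z‖ₑ * ENNReal.ofReal
      ((4 * π * t) ^ (-(n : ℝ) / 2) * Real.exp (-‖z‖ ^ 2 / (4 * t)))
      = ENNReal.ofReal (2 * Real.sqrt t / Real.sqrt π) * ‖D‖ₑ := by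
  by_cases hD : D = 0
  · subst hD
    have h0 : ‖(0 : EuclideanSpace ℝ (Fin n) →L[ℝ] ℝ)‖ₑ = 0 := by
      rw [← ofReal_norm]; simp
    rw [h0]; simp
  obtain ⟨v, rfl⟩ := (InnerProductSpace.toDual ℝ (EuclideanSpace ℝ (Fin n))).surjective D
  have hv : v ≠ 0 := by rintro rfl; simp at hD
  have hn : 0 < n := by
    rcases Nat.eq_zero_or_pos n with h | h
    · subst h; exact absurd (Subsingleton.elim v 0) hv
    · exact h
  let i0 : Fin n := ⟨0, hn⟩
  have hor : Orthonormal ℝ (({i0} : Set (Fin n)).domRestrict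
      (fun _ : Fin n => (‖v‖⁻¹ • v : EuclideanSpace ℝ (Fin n)))) := by
    constructor
    · intro i
      change ‖(‖v‖⁻¹ • v : EuclideanSpace ℝ (Fin n))‖ = 1
      rw [norm_smul, norm_inv, norm_norm, inv_mul_cancel₀ (norm_ne_zero_iff.2 hv)]
    · intro i j hij
      exact absurd (Subsingleton.elim i j) hij
  obtain ⟨b, hb⟩ := hor.exists_orthonormalBasis_extension_of_card_eq (by simp)
  have hb0 : b i0 = ‖v‖⁻¹ • v := hb i0 rfl
  have hrep : ∀ z, |(b.repr z) i0| * ‖v‖ = |inner ℝ v z| := by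
    intro z
    rw [b.repr_apply_apply, hb0, real_inner_smul_left, abs_mul, abs_inv, abs_norm]
    field_simp
  have hco := aux_coord n i0 ht
  rw [← b.measurePreserving_repr.lintegral_comp_emb
    b.measurableEquiv.measurableEmbedding] at hco
  rw [← hco, ← lintegral_mul_const']
  · refine lintegral_congr fun z => ?_
    rw [LinearIsometryEquiv.norm_map, Real.enorm_eq_ofReal_abs,
      InnerProductSpace.toDual_apply_apply, ← hrep, LinearIsometryEquiv.enorm_map,
      ← ofReal_norm, ← ENNReal.ofReal_mul (by positivity),
      ← ENNReal.ofReal_mul (by positivity)]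
    congr 1
    ring
  · simp

lemma aux_shift (n : ℕ) (L : NNReal) (f : EuclideanSpace ℝ (Fin n) → ℝ)
    (hf : LipschitzWith L f) (z : EuclideanSpace ℝ (Fin n)) :
    ∫⁻ x, ‖f x - f (x + z)‖ₑ ≤ ∫⁻ x, ‖fderiv ℝ f x z‖ₑ := by
  have hm : Measurable fun x => ‖fderiv ℝ f x z‖ₑ :=
    (measurable_fderiv_apply_const ℝ f z).enorm
  have hS : MeasurableSet {x | DifferentiableAt ℝ f x} := measurableSet_of_differentiableAt ℝ f
  have hae := hf.ae_differentiableAt (μ := (volume : Measure (EuclideanSpace ℝ (Fin n))))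
  have hae2 : ∀ᵐ x : EuclideanSpace ℝ (Fin n), ∀ᵐ s : ℝ, DifferentiableAt ℝ f (x + s • z) := by
    rw [Measure.ae_ae_comm]
    · refine Eventually.of_forall fun s => ?_
      exact (measurePreserving_add_right volume (s • z)).quasiMeasurePreserving.ae hae
    · exact hS.preimage (f := fun p : EuclideanSpace ℝ (Fin n) × ℝ => p.1 + p.2 • z)
        (by fun_prop)
  have key : ∀ᵐ x : EuclideanSpace ℝ (Fin n),
      ‖f x - f (x + z)‖ₑ ≤ ∫⁻ s in Set.Ioc (0 : ℝ) 1, ‖fderiv ℝ f (x + s • z) z‖ₑ := by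
    filter_upwards [hae2] with x hx
    have hl : LipschitzWith (L * ‖z‖₊) (fun s : ℝ => f (x + s • z)) := by
      refine hf.comp (LipschitzWith.of_dist_le_mul fun s s' => ?_)
      rw [dist_add_left, dist_eq_norm, ← sub_smul, norm_smul, dist_eq_norm, mul_comm]
      rfl
    have hftc := (hl.lipschitzOnWith (s := Set.uIcc 0 1)).absolutelyContinuousOnInterval.integral_deriv_eq_sub
    simp only [one_smul, zero_smul, add_zero] at hftc
    rw [intervalIntegral.integral_of_le zero_le_one] at hftc
    rw [← enorm_neg, neg_sub, ← hftc]
    refine (enorm_integral_le_lintegral_enorm _).trans (le_of_eq ?_)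
    refine lintegral_congr_ae ?_
    filter_upwards [ae_restrict_of_ae hx] with s hs
    have hg : HasDerivAt (fun s : ℝ => x + s • z) z s := by
      simpa using ((hasDerivAt_id s).smul_const z).const_add x
    have := hs.hasFDerivAt.comp_hasDerivAt s hg
    rw [← this.deriv]; rfl
  calc _ ≤ ∫⁻ x, ∫⁻ s in Set.Ioc (0 : ℝ) 1, ‖fderiv ℝ f (x + s • z) z‖ₑ := lintegral_mono_ae key
    _ = ∫⁻ s in Set.Ioc (0 : ℝ) 1, ∫⁻ x, ‖fderiv ℝ f (x + s • z) z‖ₑ := by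
      refine lintegral_lintegral_swap (Measurable.aemeasurable ?_)
      exact hm.comp (g := fun x => ‖fderiv ℝ f x z‖ₑ)
        (f := fun p : EuclideanSpace ℝ (Fin n) × ℝ => p.1 + p.2 • z) (by fun_prop)
    _ = ∫⁻ s in Set.Ioc (0 : ℝ) 1, ∫⁻ x, ‖fderiv ℝ f x z‖ₑ := by
      refine lintegral_congr fun s => ?_
      exact lintegral_add_right_eq_self (fun x => ‖fderiv ℝ f x z‖ₑ) (s • z)
    _ = _ := by simp

lemma aux_pointwise (n : ℕ) (L : NNReal)
    (f : EuclideanSpace ℝ (Fin n) → ℝ)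
    (hf : LipschitzWith L f) (hsupp : HasCompactSupport f) {t : ℝ} (ht : 0 < t) :
    (1 / Real.sqrt t) *
          ∫ x : EuclideanSpace ℝ (Fin n), ∫ y : EuclideanSpace ℝ (Fin n),
            |f x - f y| * ((4 * π * t) ^ (-(n : ℝ) / 2)
              * Real.exp (-‖x - y‖ ^ 2 / (4 * t)))
      ≤ 2 / Real.sqrt π * ∫ x : EuclideanSpace ℝ (Fin n), ‖fderiv ℝ f x‖ := by
  have hmf : Measurable (fderiv ℝ f) := measurable_fderiv ℝ f
  have hint : Integrable (fderiv ℝ f) := by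
    have hc : HasCompactSupport (fderiv ℝ f) := hsupp.fderiv (𝕜 := ℝ)
    refine (integrable_norm_iff hmf.aestronglyMeasurable).1 ?_
    have hc' : HasCompactSupport (fun x => ‖fderiv ℝ f x‖) := hc.norm
    refine (integrableOn_iff_integrable_of_support_subset
      (subset_tsupport (fun x => ‖fderiv ℝ f x‖))).1 ?_
    refine Measure.integrableOn_of_bounded (M := L) hc'.isCompact.measure_lt_top.ne
      hmf.norm.aestronglyMeasurable ?_
    exact Eventually.of_forall fun x => by
      rw [norm_norm]; exact norm_fderiv_le_of_lipschitz ℝ hf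
  have hfc := hf.continuous
  set K : EuclideanSpace ℝ (Fin n) → ℝ := fun z =>
    (4 * π * t) ^ (-(n : ℝ) / 2) * Real.exp (-‖z‖ ^ 2 / (4 * t)) with hK
  have hKc : Continuous K := by fun_prop
  have hK0 : ∀ z, 0 ≤ K z := fun z => by positivity
  have hKneg : ∀ z, K (-z) = K z := fun z => by simp [hK]
  set I := ∫ x : EuclideanSpace ℝ (Fin n), ∫ y : EuclideanSpace ℝ (Fin n),
            |f x - f y| * K (x - y) with hI
  have main : ENNReal.ofReal I ≤
      ENNReal.ofReal (2 * √t / √π * ∫ x : EuclideanSpace ℝ (Fin n), ‖fderiv ℝ f x‖) := by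
    calc ENNReal.ofReal I ≤ ‖I‖ₑ := Real.ofReal_le_enorm I
      _ ≤ ∫⁻ x, ∫⁻ y, ‖|f x - f y| * K (x - y)‖ₑ :=
        (enorm_integral_le_lintegral_enorm _).trans
          (lintegral_mono fun x => enorm_integral_le_lintegral_enorm _)
      _ = ∫⁻ x, ∫⁻ z, ‖f x - f (x + z)‖ₑ * ENNReal.ofReal (K z) := by
        refine lintegral_congr fun x => ?_
        rw [← lintegral_add_left_eq_self _ x]
        refine lintegral_congr fun z => ?_
        rw [enorm_mul, Real.enorm_abs, sub_add_cancel_left, hKneg, Real.enorm_of_nonneg (hK0 z)]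
      _ = ∫⁻ z, ∫⁻ x, ‖f x - f (x + z)‖ₑ * ENNReal.ofReal (K z) := by
        refine lintegral_lintegral_swap (Measurable.aemeasurable ?_)
        refine Continuous.measurable ?_ |>.enorm.mul (Continuous.measurable ?_).ennreal_ofReal <;>
          fun_prop
      _ ≤ ∫⁻ z, ∫⁻ x, ‖fderiv ℝ f x z‖ₑ * ENNReal.ofReal (K z) := by
        refine lintegral_mono fun z => ?_
        dsimp only
        rw [lintegral_mul_const' _ _ (by simp), lintegral_mul_const' _ _ (by simp)]
        exact mul_le_mul_left (aux_shift n L f hf z) _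
      _ = ∫⁻ x, ∫⁻ z, ‖fderiv ℝ f x z‖ₑ * ENNReal.ofReal (K z) := by
        refine lintegral_lintegral_swap (Measurable.aemeasurable ?_)
        refine Measurable.mul (Measurable.enorm ?_) (by fun_prop)
        exact isBoundedBilinearMap_apply.continuous.measurable.comp
          ((hmf.comp measurable_snd).prodMk measurable_fst)
      _ = ∫⁻ x, ENNReal.ofReal (2 * √t / √π) * ‖fderiv ℝ f x‖ₑ :=
        lintegral_congr fun x => aux_moment n _ ht
      _ = _ := by
        rw [lintegral_const_mul' _ _ (by simp), ENNReal.ofReal_mul (by positivity),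
          ofReal_integral_norm_eq_lintegral_enorm hint]
  have hR : 0 ≤ 2 * √t / √π * ∫ x : EuclideanSpace ℝ (Fin n), ‖fderiv ℝ f x‖ := by positivity
  have main' := (ENNReal.ofReal_le_ofReal_iff hR).1 main
  have hst : 0 < √t := Real.sqrt_pos.2 ht
  calc 1 / √t * I ≤ 1 / √t * (2 * √t / √π * ∫ x : EuclideanSpace ℝ (Fin n), ‖fderiv ℝ f x‖) := by
        gcongr
    _ = _ := by field_simp

/-- Upper-bound half of Proposition 5.6 in the Euclidean model: for a
Lipschitz function `f : ℝⁿ → ℝ` with compact support,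
`limsup_{t→0⁺} (1/√t) ∫∫ |f(x)-f(y)| (4πt)^{-n/2} e^{-|x-y|²/(4t)} dy dx
  ≤ (2/√π) ∫ |∇f| dx`,
where `∇f` exists a.e. by Rademacher's theorem. -/
theorem lipschitz_limsup_upper_bound (n : ℕ) (hn : 1 ≤ n) (L : NNReal)
    (f : EuclideanSpace ℝ (Fin n) → ℝ)
    (hf : LipschitzWith L f) (hsupp : HasCompactSupport f) :
    Filter.limsup (fun t : ℝ =>
        (1 / Real.sqrt t) *
          ∫ x : EuclideanSpace ℝ (Fin n), ∫ y : EuclideanSpace ℝ (Fin n),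
            |f x - f y| * ((4 * π * t) ^ (-(n : ℝ) / 2)
              * Real.exp (-‖x - y‖ ^ 2 / (4 * t))))
      (𝓝[>] 0)
      ≤ 2 / Real.sqrt π * ∫ x : EuclideanSpace ℝ (Fin n), ‖fderiv ℝ f x‖ := by
  refine limsup_le_of_le ?_ ?_
  · refine IsBoundedUnder.isCoboundedUnder_le ⟨0, ?_⟩
    refine eventually_map.2 ?_
    filter_upwards [self_mem_nhdsWithin] with t ht
    have ht' : (0 : ℝ) < t := ht
    have hp : 0 < 4 * π * t := by positivity
    refine mul_nonneg (by positivity) (integral_nonneg fun x => integral_nonneg fun y => ?_)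
    exact mul_nonneg (abs_nonneg _) (mul_nonneg (Real.rpow_nonneg hp.le _) (Real.exp_pos _).le)
  · filter_upwards [self_mem_nhdsWithin] with t ht
    exact aux_pointwise n L f hf hsupp ht
end
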